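/- Let U_q^+(sl_4) be the ℂ(q)-algebra presented by generators E_1, E_2, E_3 and relations E_1E_3 = E_3E_1 and E_i²E_j − (q+q^{−1})E_iE_jE_i + E_jE_i² = 0 for all i,j ∈ {1,2,3} with |i−j|=1. Set u_1 = E_1 + E_3 and u_2 = E_2. Then: (a) u_2²u_1 − (q+q^{−1})u_2u_1u_2 + u_1u_2² = 0; but (b) if c_0, c_1, c_2, c_3 ∈ ℂ(q) satisfy Σ_{j=0}^{3} c_j u_1^j u_2 u_1^{3−j} = 0 in U_q^+(sl_4), then c_0 = c_1 = c_2 = c_3 = 0. In particular, u_1 and u_2 do not satisfy the quantum Serre relation of U_q^+(so_5) in the variable u_1. -/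

import Mathlib

noncomputable section

/-- The field `ℂ(q)` of rational functions. -/
abbrev Kq := RatFunc ℂ
/-- The variable `q`. -/
def qq : Kq := RatFunc.X

/-- The generator `E_{i+1}` of the free algebra on three generators. -/
def Efree (i : Fin 3) : FreeAlgebra Kq (Fin 3) := FreeAlgebra.ι Kq i

/-- The defining relations of `U_q^+(sl₄)` on the generators `E₁, E₂, E₃`
(indexed here by `0, 1, 2 : Fin 3`): `E₁E₃ = E₃E₁` and the quantum Serre relations
`E_i²E_j − (q+q⁻¹)E_iE_jE_i + E_jE_i² = 0` for `|i−j| = 1`. -/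
inductive SL4Rel : FreeAlgebra Kq (Fin 3) → FreeAlgebra Kq (Fin 3) → Prop
  | comm : SL4Rel (Efree 0 * Efree 2) (Efree 2 * Efree 0)
  | serre (i j : Fin 3) (h : (i : ℕ) + 1 = (j : ℕ) ∨ (j : ℕ) + 1 = (i : ℕ)) :
      SL4Rel (Efree i * Efree i * Efree j + Efree j * Efree i * Efree i)
        ((qq + qq⁻¹) • (Efree i * Efree j * Efree i))

/-- `U_q^+(sl₄)`. -/
abbrev UqSL4 := RingQuot SL4Rel

/-- The generator `E_{i+1}` of `U_q^+(sl₄)`. -/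
def EE (i : Fin 3) : UqSL4 := RingQuot.mkAlgHom Kq SL4Rel (Efree i)

theorem qq_ne_zero : qq ≠ 0 := RatFunc.X_ne_zero

theorem qq_sub_inv_ne : qq - qq⁻¹ ≠ 0 := by
  intro h
  have h1 : qq * qq = 1 := by
    have h2 : qq = qq⁻¹ := sub_eq_zero.mp h
    nth_rewrite 2 [h2]
    exact mul_inv_cancel₀ qq_ne_zero
  have h3 : algebraMap (Polynomial ℂ) (RatFunc ℂ) (Polynomial.X * Polynomial.X)
      = algebraMap (Polynomial ℂ) (RatFunc ℂ) 1 := by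
    rw [map_mul, map_one, RatFunc.algebraMap_X]
    exact h1
  have h4 := RatFunc.algebraMap_injective ℂ h3
  have h5 := congrArg (Polynomial.eval 0) h4
  simp at h5

/-- Images of the generators in a two-dimensional representation. -/
def repGen (a b : Kq) (i : Fin 3) : Matrix (Fin 2) (Fin 2) Kq :=
  match i with
  | 0 => !![1, 0; 0, a]
  | 1 => !![0, 0; 1, 0]
  | 2 => !![2, 0; 0, 2 * b]

theorem repGen_rel (a b : Kq) (ha : 1 + a * a = (qq + qq⁻¹) * a)
    (hb : 1 + b * b = (qq + qq⁻¹) * b) ⦃x y : FreeAlgebra Kq (Fin 3)⦄ (h : SL4Rel x y) :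
    FreeAlgebra.lift Kq (repGen a b) x = FreeAlgebra.lift Kq (repGen a b) y := by
  cases h with
  | comm =>
    simp only [Efree, map_mul, FreeAlgebra.lift_ι_apply, repGen]
    ext i j
    fin_cases i <;> fin_cases j <;> simp [Matrix.mul_apply, Fin.sum_univ_two] <;> ring
  | serre i j h =>
    simp only [Efree, map_mul, map_add, map_smul, FreeAlgebra.lift_ι_apply]
    fin_cases i <;> fin_cases j <;> simp at h <;> ext k l <;> fin_cases k <;> fin_cases l <;>
      simp [repGen, Matrix.mul_apply, Fin.sum_univ_two] <;> grind

/-- The two-dimensional representation. -/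
def rep (a b : Kq) (ha : 1 + a * a = (qq + qq⁻¹) * a) (hb : 1 + b * b = (qq + qq⁻¹) * b) :
    UqSL4 →ₐ[Kq] Matrix (Fin 2) (Fin 2) Kq :=
  RingQuot.liftAlgHom Kq ⟨FreeAlgebra.lift Kq (repGen a b), repGen_rel a b ha hb⟩

theorem rep_EE (a b : Kq) (ha : 1 + a * a = (qq + qq⁻¹) * a)
    (hb : 1 + b * b = (qq + qq⁻¹) * b) (i : Fin 3) : rep a b ha hb (EE i) = repGen a b i := by
  simp [rep, EE, Efree]

theorem rep_cubic (a b : Kq) (ha : 1 + a * a = (qq + qq⁻¹) * a)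
    (hb : 1 + b * b = (qq + qq⁻¹) * b) (c : Fin 4 → Kq)
    (h : (∑ j : Fin 4, c j • ((EE 0 + EE 2) ^ (j : ℕ) * EE 1 *
      (EE 0 + EE 2) ^ (3 - (j : ℕ)))) = 0) :
    27 * c 0 + 9 * c 1 * (a + 2 * b) + 3 * c 2 * (a + 2 * b) ^ 2 + c 3 * (a + 2 * b) ^ 3 = 0 := by
  have h1 := congrArg (rep a b ha hb) h
  have hu : repGen a b 0 + repGen a b 2 = Matrix.diagonal ![3, a + 2 * b] := by
    ext i j
    fin_cases i <;> fin_cases j <;> simp [repGen] <;> norm_num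
  simp only [map_sum, map_smul, map_mul, map_pow, map_add, map_zero, rep_EE, hu,
    Matrix.diagonal_pow] at h1
  have h2 := congrFun (congrFun h1 1) 0
  simp [Fin.sum_univ_four, repGen, Matrix.vecMul_diagonal] at h2
  linear_combination h2

theorem lin_indep (c : Fin 4 → Kq)
    (h : (∑ j : Fin 4, c j • ((EE 0 + EE 2) ^ (j : ℕ) * EE 1 *
      (EE 0 + EE 2) ^ (3 - (j : ℕ)))) = 0) : ∀ j, c j = 0 := by
  have hq := mul_inv_cancel₀ qq_ne_zero
  have hne := qq_sub_inv_ne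
  have ha : 1 + qq * qq = (qq + qq⁻¹) * qq := by linear_combination -hq
  have hb : 1 + qq⁻¹ * qq⁻¹ = (qq + qq⁻¹) * qq⁻¹ := by linear_combination -hq
  have e1 := rep_cubic _ _ ha ha c h
  have e2 := rep_cubic _ _ ha hb c h
  have e3 := rep_cubic _ _ hb ha c h
  have e4 := rep_cubic _ _ hb hb c h
  have key := Matrix.eq_zero_of_forall_index_sum_pow_mul_eq_zero
    (f := ![qq + 2 * qq, qq + 2 * qq⁻¹, qq⁻¹ + 2 * qq, qq⁻¹ + 2 * qq⁻¹])
    (v := ![27 * c 0, 9 * c 1, 3 * c 2, c 3]) ?_ ?_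
  · have k0 := congrFun key 0
    have k1 := congrFun key 1
    have k2 := congrFun key 2
    have k3 := congrFun key 3
    simp at k0 k1 k2 k3
    intro j
    fin_cases j <;> assumption
  · have n2 : (2 : Kq) ≠ 0 := two_ne_zero
    have n3 : (3 : Kq) ≠ 0 := three_ne_zero
    intro i j hij
    fin_cases i <;> fin_cases j <;> simp at hij ⊢ <;> exfalso <;> grind
  · intro j
    fin_cases j <;> simp [Fin.sum_univ_four]
    · linear_combination e1
    · linear_combination e2
    · linear_combination e3
    · linear_combination e4

theorem EE_serre (i j : Fin 3) (h : (i : ℕ) + 1 = (j : ℕ) ∨ (j : ℕ) + 1 = (i : ℕ)) :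
    EE i * EE i * EE j + EE j * EE i * EE i = (qq + qq⁻¹) • (EE i * EE j * EE i) := by
  have := RingQuot.mkAlgHom_rel Kq (SL4Rel.serre i j h)
  simp only [map_add, map_mul, map_smul] at this
  exact this

/-- **Naive quantum folding does not exist (Appendix A).**
Let `u₁ = E₁ + E₃` and `u₂ = E₂` in `U_q^+(sl₄)`.  Then
(a) `u₂²u₁ − (q+q⁻¹)u₂u₁u₂ + u₁u₂² = 0`;
(b) any relation `∑_{j=0}^{3} c_j u₁ʲ u₂ u₁^{3−j} = 0` forces `c₀ = c₁ = c₂ = c₃ = 0`; in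
particular `u₁, u₂` do not satisfy the degree-4 quantum Serre relation of `U_q^+(so₅)` in the
variable `u₁`. -/
theorem no_naive_quantum_folding :
    (EE 1 * EE 1 * (EE 0 + EE 2) - (qq + qq⁻¹) • (EE 1 * (EE 0 + EE 2) * EE 1)
        + (EE 0 + EE 2) * EE 1 * EE 1 = 0) ∧
    (∀ c : Fin 4 → Kq,
      (∑ j : Fin 4, c j • ((EE 0 + EE 2) ^ (j : ℕ) * EE 1 * (EE 0 + EE 2) ^ (3 - (j : ℕ)))) = 0 →
      ∀ j, c j = 0) ∧
    ¬ ((EE 0 + EE 2) ^ 3 * EE 1 - (qq ^ 2 + 1 + qq⁻¹ ^ 2) • ((EE 0 + EE 2) ^ 2 * EE 1 * (EE 0 + EE 2))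
        + (qq ^ 2 + 1 + qq⁻¹ ^ 2) • ((EE 0 + EE 2) * EE 1 * (EE 0 + EE 2) ^ 2)
        - EE 1 * (EE 0 + EE 2) ^ 3 = 0) := by
  refine ⟨?_, lin_indep, ?_⟩
  · have h0 := EE_serre 1 0 (by decide)
    have h2 := EE_serre 1 2 (by decide)
    have : EE 1 * EE 1 * (EE 0 + EE 2) - (qq + qq⁻¹) • (EE 1 * (EE 0 + EE 2) * EE 1)
        + (EE 0 + EE 2) * EE 1 * EE 1
        = (EE 1 * EE 1 * EE 0 + EE 0 * EE 1 * EE 1 - (qq + qq⁻¹) • (EE 1 * EE 0 * EE 1))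
        + (EE 1 * EE 1 * EE 2 + EE 2 * EE 1 * EE 1 - (qq + qq⁻¹) • (EE 1 * EE 2 * EE 1)) := by
      simp only [mul_add, add_mul, smul_add]
      abel
    rw [this, h0, h2, sub_self, sub_self, add_zero]
  · intro h
    have hneg : ∀ (a : Kq) (x : UqSL4), (-a) • x = -(a • x) := fun a x => neg_smul a x
    have := lin_indep ![-1, qq ^ 2 + 1 + qq⁻¹ ^ 2, -(qq ^ 2 + 1 + qq⁻¹ ^ 2), 1] (by
      rw [← h, Fin.sum_univ_four]
      simp only [Matrix.cons_val, Fin.val_zero, Fin.val_one, Fin.val_two, Fin.isValue,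
        Fin.coe_ofNat_eq_mod, Nat.reduceMod, Nat.reduceSub, pow_zero, pow_one, one_mul, mul_one,
        one_smul, hneg]
      abel) 3
    simp at this

end
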